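/- arXiv:math/0203134 — 2 statements merged into one kernel-verified Lean document; each statement's English description precedes it below -/
import Mathlib

section
/- Let p be an odd prime, A a commutative ring, and π ∈ A an element such that (p : A) + π^(p−1) ∈ π^p·A (i.e. p ≡ −π^(p−1) mod π^p). Then for every r ∈ A one has (1 + r·π)^p − (1 + (r^p − r)·π^p) ∈ π^(p+1)·A; that is, (1 + rπ)^p ≡ 1 + (r^p − r)π^p (mod π^(p+1)). -/
/-- For a prime `p`, the binomial expansion of `(1 + x) ^ p` is `1 + p * x + x ^ p` up to a multiple
of `p * x ^ 2`. -/
theorem Nat.Prime.dvd_one_add_pow_sub {A : Type*} [CommRing A] {p : ℕ} (hp : p.Prime) (x : A) :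
    (p : A) * x ^ 2 ∣ (1 + x) ^ p - (1 + p * x + x ^ p) := by
  obtain ⟨n, rfl⟩ := Nat.exists_eq_add_of_le' hp.two_le
  have key : (1 + x) ^ (n + 2) - (1 + ((n + 2 : ℕ) : A) * x + x ^ (n + 2)) =
      ∑ k ∈ Finset.range n, x ^ (k + 2) * ((n + 2).choose (k + 2) : A) := by
    rw [add_comm 1 x, add_pow, Finset.sum_range_succ, Finset.sum_range_succ',
      Finset.sum_range_succ']
    simp only [one_pow, mul_one, zero_add, pow_zero, pow_one, Nat.choose_zero_right,
      Nat.choose_one_right, Nat.choose_self, Nat.cast_one]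
    ring
  rw [key]
  refine Finset.dvd_sum fun k hk => ?_
  rw [mul_comm (x ^ (k + 2))]
  refine mul_dvd_mul (Nat.cast_dvd_cast ?_) (pow_dvd_pow x (Nat.le_add_left 2 k))
  have hk := Finset.mem_range.mp hk
  exact hp.dvd_choose_self (by omega) (by omega)

/-- If `p` is an odd prime and `π ∈ A` satisfies `p ≡ -π^(p-1) (mod π^p)`, then
`(1 + rπ)^p ≡ 1 + (r^p - r)π^p (mod π^(p+1))` for every `r ∈ A`. -/
theorem one_add_rpi_pow_p (p : ℕ) (hp : p.Prime) (hodd : p ≠ 2) {A : Type*}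
    [CommRing A] (π : A) (h : (p : A) + π ^ (p - 1) ∈ Ideal.span {π ^ p}) :
    ∀ r : A, (1 + r * π) ^ p - (1 + (r ^ p - r) * π ^ p) ∈
      Ideal.span {π ^ (p + 1)} := by
  intro r
  rw [Ideal.mem_span_singleton] at h ⊢
  obtain ⟨c, hc⟩ := h
  obtain ⟨s, hs⟩ := hp.dvd_one_add_pow_sub (r * π)
  have hpow : π ^ p = π ^ (p - 1) * π := (pow_sub_one_mul hp.ne_zero π).symm
  rw [mul_pow r π p, hpow] at hs
  rw [hpow] at hc
  rw [pow_succ, hpow]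
  refine ⟨c * r + (π * c - 1) * r ^ 2 * s, ?_⟩
  linear_combination hs + (r * π + (r * π) ^ 2 * s) * hc
end

section
/- Let p be an odd prime, A a commutative ring, and π ∈ A an element such that (p : A) ∈ π^(p−1)·A. Let s and t be natural numbers and set q = (1 − π)^s · (1 + π^p)^t ∈ A. Then in the module of Kähler differentials Ω_{A/ℤ}, with universal derivation D : A → Ω_{A/ℤ}, there exists a ∈ A such that (1 − π)·D(q) + (s : A)·q·D(π) = (π·a)·D(π). -/
/-- For `q = (1-π)^s·(1+π^p)^t` in a commutative ring `A` with `π^(p-1) ∣ p`, the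
Kähler differential identity `(1-π)·dq + s·q·dπ ≡ 0 (mod π·dπ)` holds; i.e.
`d log q ≡ (-s/(1-π))·dπ (mod π·dπ)`. -/
theorem dlog_q_formula (p : ℕ) (hp : p.Prime) (hodd : p ≠ 2) {A : Type*}
    [CommRing A] (π : A) (h : (p : A) ∈ Ideal.span {π ^ (p - 1)}) (s t : ℕ) :
    ∃ a : A,
      (1 - π) • (KaehlerDifferential.D ℤ A) ((1 - π) ^ s * (1 + π ^ p) ^ t) +
          ((s : A) * ((1 - π) ^ s * (1 + π ^ p) ^ t)) • (KaehlerDifferential.D ℤ A) π =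
        (π * a) • (KaehlerDifferential.D ℤ A) π := by
  obtain ⟨k, rfl⟩ : ∃ k, p = k + 2 := ⟨p - 2, by have := hp.two_le; omega⟩
  refine ⟨(1 - π) ^ (s + 1) * t * (1 + π ^ (k + 2)) ^ (t - 1) * (k + 2 : ℕ) * π ^ k, ?_⟩
  have hs : (s : A) * ((1 - π) * (1 - π) ^ (s - 1)) = s * (1 - π) ^ s := by
    cases s with
    | zero => simp
    | succ n => rw [Nat.add_sub_cancel, pow_succ']
  simp only [Derivation.leibniz, Derivation.leibniz_pow, map_add, map_sub,
    Derivation.map_one_eq_zero, zero_add, zero_sub, ← Nat.cast_smul_eq_nsmul A, smul_smul,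
    smul_neg, ← neg_smul, ← add_smul]
  congr 1
  rw [show k + 2 - 1 = k + 1 by omega]
  linear_combination -(1 + π ^ (k + 2)) ^ t * hs
end
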